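/- For every real E with E ∉ σ(A) and E ∉ {ε_1, …, ε_n}, if γ(E) = E + c + Σ_{j=1}^n w_j/(ε_j − E) is an eigenvalue of H_o, then E is an eigenvalue of H, and the dimension of the eigenspace of H at E is at least the dimension of the eigenspace of H_o at γ(E). -/

import Mathlib

open scoped InnerProductSpace

/- Context: `Γ` is a nonempty countable set, `G` a nonempty finite set, `O ∈ G`.
`ℓ²(Γ)` is formalized as `lp (fun _ : Γ => ℂ) 2` with standard basis vectors
`lp.single 2 x 1`, and `ℓ²(G)` as `EuclideanSpace ℂ G` with standard basis vectors
`EuclideanSpace.single u 1`.  `H_o` is a bounded self-adjoint operator on `ℓ²(Γ)`,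
`A` a self-adjoint operator on `ℓ²(G)`, and the decorated Hamiltonian `H` is the
bounded self-adjoint operator on `ℓ²(Γ × G)` determined by the matrix elements
`⟪δ_{(x,u)}, H δ_{(y,v)}⟫ = [u = O]·[v = O]·⟪δ_x, H_o δ_y⟫ + [x = y]·⟪δ_u, A δ_v⟫`.
Resolvents `(B - z)⁻¹` are expressed as `Ring.inverse (B - z • 1)`, which agrees
with the resolvent whenever `z ∉ σ(B)`. -/
universe u v

theorem Cardinal.lift_le_of_lift_max_le {a : Cardinal.{u}} {b : Cardinal.{max u v}}
    (h : Cardinal.lift.{max u v} a ≤ Cardinal.lift.{u} b) : Cardinal.lift.{v} a ≤ b := by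
  rwa [Cardinal.lift_umax.{u, v}, Cardinal.lift_id'.{u, max u v}] at h

/-- The elementary tensor `ψ ⊗ g` in `ℓ²(Γ × G)`, as a linear function of `ψ ∈ ℓ²(Γ)`. -/
noncomputable def lpTensorRight {Γ G : Type*} [Fintype G] (g : EuclideanSpace ℂ G) :
    lp (fun _ : Γ => ℂ) 2 →ₗ[ℂ] lp (fun _ : Γ × G => ℂ) 2 where
  toFun ψ := ⟨fun p => ψ p.1 * g p.2, by
    have h2 : 0 < (2 : ENNReal).toReal := by norm_num
    have h := (memℓp_gen_iff h2).1 (lp.memℓp ψ)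
    have h' : Summable fun u : G => ‖g u‖ ^ (2 : ENNReal).toReal := (hasSum_fintype _).summable
    refine (memℓp_gen_iff h2).2 ((h.mul_of_nonneg h' (fun _ => ?_) fun _ => ?_).congr fun p => ?_)
    · positivity
    · positivity
    · rw [norm_mul, Real.mul_rpow (norm_nonneg _) (norm_nonneg _)]⟩
  map_add' ψ χ := by
    ext p
    exact add_mul _ _ _
  map_smul' a ψ := by
    ext p
    exact mul_assoc _ _ _

section lpTensorRight

variable {Γ G : Type*} [Fintype G]

@[simp]
theorem lpTensorRight_apply (g : EuclideanSpace ℂ G) (ψ : lp (fun _ : Γ => ℂ) 2) (p : Γ × G) :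
    lpTensorRight g ψ p = ψ p.1 * g p.2 :=
  rfl

theorem inner_lpTensorRight (a b : EuclideanSpace ℂ G) (χ ψ : lp (fun _ : Γ => ℂ) 2) :
    ⟪lpTensorRight a χ, lpTensorRight b ψ⟫_ℂ = ⟪χ, ψ⟫_ℂ * ⟪a, b⟫_ℂ := by
  have hs := lp.summable_inner (𝕜 := ℂ) (lpTensorRight a χ) (lpTensorRight b ψ)
  rw [lp.inner_eq_tsum, hs.tsum_prod, lp.inner_eq_tsum, ← tsum_mul_right]
  refine tsum_congr fun x => ?_
  rw [tsum_fintype, PiLp.inner_apply, Finset.mul_sum]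
  refine Finset.sum_congr rfl fun u _ => ?_
  simp only [lpTensorRight_apply, RCLike.inner_apply, map_mul]
  ring

theorem lpTensorRight_injective {g : EuclideanSpace ℂ G} {u : G} (hg : g u ≠ 0) :
    Function.Injective (lpTensorRight (Γ := Γ) g) := by
  intro ψ χ h
  ext x
  have hx := congrArg (fun f : lp (fun _ : Γ × G => ℂ) 2 => f (x, u)) h
  exact mul_right_cancel₀ hg hx

end lpTensorRight

theorem lp_inner_single_one {Γ : Type*} [DecidableEq Γ] (x : Γ) (ψ : lp (fun _ : Γ => ℂ) 2) :
    ⟪lp.single 2 x (1 : ℂ), ψ⟫_ℂ = ψ x := by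
  rw [lp.inner_single_left]
  simp

theorem euclidean_inner_single_one {G : Type*} [Fintype G] [DecidableEq G] (u : G)
    (g : EuclideanSpace ℂ G) : ⟪EuclideanSpace.single u (1 : ℂ), g⟫_ℂ = g u := by
  simp [EuclideanSpace.inner_single_left]

section Decorated

variable {Γ G : Type*} [DecidableEq Γ] [Fintype G] [DecidableEq G] {O : G}
  {Ho : lp (fun _ : Γ => ℂ) 2 →L[ℂ] lp (fun _ : Γ => ℂ) 2}
  {A : EuclideanSpace ℂ G →L[ℂ] EuclideanSpace ℂ G}
  {H : lp (fun _ : Γ × G => ℂ) 2 →L[ℂ] lp (fun _ : Γ × G => ℂ) 2}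

theorem decorated_apply_single
    (hmat : ∀ (x y : Γ) (u v : G),
      ⟪lp.single 2 (x, u) (1 : ℂ), H (lp.single 2 (y, v) 1)⟫_ℂ
        = (if u = O then (1 : ℂ) else 0) * (if v = O then (1 : ℂ) else 0) *
            ⟪lp.single 2 x (1 : ℂ), Ho (lp.single 2 y 1)⟫_ℂ
          + (if x = y then (1 : ℂ) else 0) *
            ⟪EuclideanSpace.single u (1 : ℂ), A (EuclideanSpace.single v 1)⟫_ℂ)
    (y : Γ) (v : G) :
    H (lp.single 2 (y, v) 1) =
      (if v = O then (1 : ℂ) else 0) •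
          lpTensorRight (EuclideanSpace.single O 1) (Ho (lp.single 2 y 1)) +
        lpTensorRight (A (EuclideanSpace.single v 1)) (lp.single 2 y 1) := by
  ext ⟨x, u⟩
  have h := hmat x y u v
  rw [lp_inner_single_one, lp_inner_single_one, euclidean_inner_single_one] at h
  rw [h, lp.coeFn_add, Pi.add_apply, lp.coeFn_smul, Pi.smul_apply, lpTensorRight_apply,
    lpTensorRight_apply]
  simp only [lp.coeFn_single, Pi.single_apply, PiLp.single_apply, smul_eq_mul]
  ring

theorem decorated_apply_lpTensorRight (hHo : IsSelfAdjoint Ho) (hA : IsSelfAdjoint A)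
    (hH : IsSelfAdjoint H)
    (hmat : ∀ (x y : Γ) (u v : G),
      ⟪lp.single 2 (x, u) (1 : ℂ), H (lp.single 2 (y, v) 1)⟫_ℂ
        = (if u = O then (1 : ℂ) else 0) * (if v = O then (1 : ℂ) else 0) *
            ⟪lp.single 2 x (1 : ℂ), Ho (lp.single 2 y 1)⟫_ℂ
          + (if x = y then (1 : ℂ) else 0) *
            ⟪EuclideanSpace.single u (1 : ℂ), A (EuclideanSpace.single v 1)⟫_ℂ)
    (g : EuclideanSpace ℂ G) (ψ : lp (fun _ : Γ => ℂ) 2) :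
    H (lpTensorRight g ψ) =
      g O • lpTensorRight (EuclideanSpace.single O 1) (Ho ψ) + lpTensorRight (A g) ψ := by
  ext ⟨x, u⟩
  have hsH := hH.isSymmetric (lp.single 2 (x, u) 1) (lpTensorRight g ψ)
  have hsHo := hHo.isSymmetric (lp.single 2 x 1) ψ
  have hsA := hA.isSymmetric (EuclideanSpace.single u 1) g
  simp only [ContinuousLinearMap.coe_coe] at hsH hsHo hsA
  rw [← lp_inner_single_one, ← hsH, decorated_apply_single hmat, inner_add_left,
    inner_smul_left, inner_lpTensorRight, inner_lpTensorRight, hsHo, hsA, lp_inner_single_one,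
    lp_inner_single_one, euclidean_inner_single_one, euclidean_inner_single_one, lp.coeFn_add,
    Pi.add_apply, lp.coeFn_smul, Pi.smul_apply, lpTensorRight_apply, lpTensorRight_apply]
  by_cases h : u = O
  · simp [h, mul_comm]
  · simp [h]

end Decorated

theorem partialFraction_ne_zero (c : ℝ) {n : ℕ} (ε w : Fin n → ℝ) (hw : ∀ j, 0 < w j)
    {z : ℂ} (hz : z.im ≠ 0) :
    z + (c : ℂ) + ∑ j, (w j : ℂ) / ((ε j : ℂ) - z) ≠ 0 := by
  intro h
  have him := congrArg Complex.im h
  have hterm : ∀ j, ((w j : ℂ) / ((ε j : ℂ) - z)).im =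
      z.im * (w j / Complex.normSq ((ε j : ℂ) - z)) := by
    intro j
    simp [Complex.div_im]
    ring
  simp only [Complex.add_im, Complex.ofReal_im, add_zero, Complex.im_sum, hterm,
    ← Finset.mul_sum, Complex.zero_im] at him
  have hnn : 0 ≤ ∑ j, w j / Complex.normSq ((ε j : ℂ) - z) :=
    Finset.sum_nonneg fun j _ => div_nonneg (hw j).le (Complex.normSq_nonneg _)
  have : z.im * (1 + ∑ j, w j / Complex.normSq ((ε j : ℂ) - z)) = 0 := by linarith
  rcases mul_eq_zero.1 this with h0 | h0
  · exact hz h0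
  · linarith

/-- The identity `m(z) γ(z) = -1` extends from the non-real `z` to real points off the spectrum. -/
theorem resolvent_entry_mul_partialFraction {V : Type*} [NormedAddCommGroup V]
    [InnerProductSpace ℂ V] [CompleteSpace V] (A : V →L[ℂ] V) (e : V)
    (c : ℝ) {n : ℕ} (ε w : Fin n → ℝ) (hw : ∀ j, 0 < w j)
    (hpf : ∀ z : ℂ, z.im ≠ 0 →
      -(⟪e, (Ring.inverse (A - z • 1)) e⟫_ℂ)⁻¹
        = z + (c : ℂ) + ∑ j, (w j : ℂ) / ((ε j : ℂ) - z))
    (E : ℝ) (hEA : IsUnit (A - (E : ℂ) • 1)) (hE : ∀ j, E ≠ ε j) :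
    ⟪e, (Ring.inverse (A - (E : ℂ) • 1)) e⟫_ℂ *
      ((E + c + ∑ j, w j / (ε j - E) : ℝ) : ℂ) = -1 := by
  obtain ⟨U, hU⟩ := hEA
  have hR : ContinuousAt (fun z : ℂ => Ring.inverse (A - z • 1)) (E : ℂ) := by
    refine ContinuousAt.comp (g := Ring.inverse) (f := fun z : ℂ => A - z • 1) ?_ (by fun_prop)
    rw [← hU]
    exact NormedRing.inverse_continuousAt U
  have hm : ContinuousAt (fun z : ℂ => ⟪e, (Ring.inverse (A - z • 1)) e⟫_ℂ) (E : ℂ) :=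
    continuousAt_const.inner (𝕜 := ℂ) (hR.clm_apply continuousAt_const)
  have hγ : ContinuousAt (fun z : ℂ => z + (c : ℂ) + ∑ j, (w j : ℂ) / ((ε j : ℂ) - z))
      (E : ℂ) := by
    refine (continuousAt_id.add continuousAt_const).add (tendsto_finsetSum _ fun j _ => ?_)
    refine continuousAt_const.div (continuousAt_const.sub continuousAt_id) ?_
    refine sub_ne_zero.2 ?_
    exact_mod_cast (hE j).symm
  have hline : Filter.Tendsto (fun t : ℝ => (E : ℂ) + t * Complex.I) (nhdsWithin 0 {0}ᶜ)
      (nhds (E : ℂ)) := by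
    have : Continuous fun t : ℝ => (E : ℂ) + t * Complex.I := by fun_prop
    simpa using (this.tendsto 0).mono_left nhdsWithin_le_nhds
  have hlim := (hm.mul hγ).tendsto.comp hline
  have hconst : Filter.Tendsto (fun _ : ℝ => (-1 : ℂ)) (nhdsWithin 0 {0}ᶜ) (nhds (-1)) :=
    tendsto_const_nhds
  have hval := tendsto_nhds_unique_of_eventuallyEq hlim hconst ?_
  · push_cast
    exact hval
  · filter_upwards [self_mem_nhdsWithin] with t ht
    have hz : ((E : ℂ) + t * Complex.I).im ≠ 0 := by simpa using ht
    have h0 := partialFraction_ne_zero c ε w hw hz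
    simp only [Function.comp_apply, Pi.mul_apply]
    rw [← hpf _ hz] at h0 ⊢
    rw [mul_neg, mul_inv_cancel₀ fun h => h0 (by simp [h])]

/-- With a partial fraction decomposition
`−1/m(z) = z + c + Σ_j w_j/(ε_j − z)` as in the context: for every real `E` with
`E ∉ σ(A)` and `E ∉ {ε_1, …, ε_n}`, if `γ(E) = E + c + Σ_j w_j/(ε_j − E)` is an
eigenvalue of `H_o`, then `E` is an eigenvalue of `H`, and the dimension of the
eigenspace of `H` at `E` is at least the dimension of the eigenspace of `H_o` at
`γ(E)`. -/
theorem statement12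
    {Γ : Type*} [Countable Γ] [Nonempty Γ] [DecidableEq Γ]
    {G : Type*} [Fintype G] [Nonempty G] [DecidableEq G]
    (O : G)
    (Ho : lp (fun _ : Γ => ℂ) 2 →L[ℂ] lp (fun _ : Γ => ℂ) 2)
    (hHo : IsSelfAdjoint Ho)
    (A : EuclideanSpace ℂ G →L[ℂ] EuclideanSpace ℂ G)
    (hA : IsSelfAdjoint A)
    (H : lp (fun _ : Γ × G => ℂ) 2 →L[ℂ] lp (fun _ : Γ × G => ℂ) 2)
    (hH : IsSelfAdjoint H)
    (hmat : ∀ (x y : Γ) (u v : G),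
      ⟪lp.single 2 (x, u) (1 : ℂ), H (lp.single 2 (y, v) 1)⟫_ℂ
        = (if u = O then (1 : ℂ) else 0) * (if v = O then (1 : ℂ) else 0) *
            ⟪lp.single 2 x (1 : ℂ), Ho (lp.single 2 y 1)⟫_ℂ
          + (if x = y then (1 : ℂ) else 0) *
            ⟪EuclideanSpace.single u (1 : ℂ), A (EuclideanSpace.single v 1)⟫_ℂ)
    (c : ℝ) (n : ℕ) (ε : Fin n → ℝ) (w : Fin n → ℝ)
    (hε : Function.Injective ε) (hw : ∀ j, 0 < w j)
    (hpf : ∀ z : ℂ, z.im ≠ 0 →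
      -(⟪EuclideanSpace.single O (1 : ℂ),
          (Ring.inverse (A - z • 1)) (EuclideanSpace.single O 1)⟫_ℂ)⁻¹
        = z + (c : ℂ) + ∑ j, (w j : ℂ) / ((ε j : ℂ) - z))
    (E : ℝ) (hEA : (E : ℂ) ∉ spectrum ℂ A) (hE : ∀ j, E ≠ ε j)
    (heig : Module.End.HasEigenvalue
      (↑Ho : Module.End ℂ (lp (fun _ : Γ => ℂ) 2))
      ((E + c + ∑ j, w j / (ε j - E) : ℝ) : ℂ)) :
    Module.End.HasEigenvalue
      (↑H : Module.End ℂ (lp (fun _ : Γ × G => ℂ) 2)) (E : ℂ) ∧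
    Cardinal.lift
      (Module.rank ℂ
        ↥(Module.End.eigenspace (↑Ho : Module.End ℂ (lp (fun _ : Γ => ℂ) 2))
          ((E + c + ∑ j, w j / (ε j - E) : ℝ) : ℂ)))
      ≤ Module.rank ℂ
        ↥(Module.End.eigenspace (↑H : Module.End ℂ (lp (fun _ : Γ × G => ℂ) 2))
          (E : ℂ)) := by
  set γ : ℂ := ((E + c + ∑ j, w j / (ε j - E) : ℝ) : ℂ)
  have hunit : IsUnit (A - (E : ℂ) • 1) := by
    have h := spectrum.notMem_iff.1 hEA
    rwa [← IsUnit.neg_iff, neg_sub, Algebra.algebraMap_eq_smul_one] at h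
  set g : EuclideanSpace ℂ G := (Ring.inverse (A - (E : ℂ) • 1)) (EuclideanSpace.single O 1)
    with hg
  have hmul : g O * γ = -1 := by
    have h := resolvent_entry_mul_partialFraction A (EuclideanSpace.single O 1) c ε w hw hpf E
      hunit hE
    rwa [euclidean_inner_single_one] at h
  have hgO : g O ≠ 0 := fun h => by simp [h] at hmul
  have hAg : A g = (E : ℂ) • g + EuclideanSpace.single O 1 := by
    have h := congrArg (fun B : EuclideanSpace ℂ G →L[ℂ] EuclideanSpace ℂ G =>
      B (EuclideanSpace.single O 1)) (Ring.mul_inverse_cancel _ hunit)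
    have h' : A g - (E : ℂ) • g = EuclideanSpace.single O 1 := h
    rw [← h', add_sub_cancel]
  have hmem : ∀ ψ ∈ Module.End.eigenspace (↑Ho : Module.End ℂ (lp (fun _ : Γ => ℂ) 2)) γ,
      lpTensorRight g ψ ∈
        Module.End.eigenspace (↑H : Module.End ℂ (lp (fun _ : Γ × G => ℂ) 2)) (E : ℂ) := by
    intro ψ hψ
    have hψ' : Ho ψ = γ • ψ := Module.End.mem_eigenspace_iff.1 hψ
    rw [Module.End.mem_eigenspace_iff, ContinuousLinearMap.coe_coe,
      decorated_apply_lpTensorRight hHo hA hH hmat, hψ', hAg, map_smul, smul_smul, hmul]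
    ext p
    simp only [lp.coeFn_add, lp.coeFn_smul, Pi.add_apply, Pi.smul_apply, lpTensorRight_apply,
      PiLp.add_apply, PiLp.smul_apply, smul_eq_mul]
    ring
  have hinj := lpTensorRight_injective (Γ := Γ) hgO
  constructor
  · obtain ⟨ψ, hψ, hψ0⟩ := heig.exists_hasEigenvector
    exact Module.End.hasEigenvalue_of_hasEigenvector
      ⟨hmem ψ hψ, (map_ne_zero_iff _ hinj).2 hψ0⟩
  · have h := LinearMap.lift_rank_le_of_injective ((lpTensorRight g).restrict hmem)
      fun _ _ hab => Subtype.ext (hinj (congrArg Subtype.val hab))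
    exact Cardinal.lift_le_of_lift_max_le h
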